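/- With φ_{i,j} and τ_n^{i,j} as in the context, for every integer n ≥ 0 the identity (a+n)·τ_{n+1}^{0,0}τ_n^{1,1}/(τ_n^{0,0}τ_{n+1}^{1,1}) = t·(d/dt) log( τ_{n+1}^{1,1}/τ_n^{0,0} ) + c − t holds at every t > 0 where the τ-functions appearing in the denominators do not vanish (equivalently, (a+n)·√t/f_1 = t (d/dt) log(τ_{n+1}^{1,1}/τ_n^{0,0}) + c − t for f_1 = √t · τ_n^{0,0}τ_{n+1}^{1,1}/(τ_{n+1}^{0,0}τ_n^{1,1})). -/

import Mathlib

open scoped Real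

/-- Kummer's confluent hypergeometric function `F(a,c;t)` as an everywhere
convergent power series. -/
noncomputable def kummerF (a c : ℂ) (t : ℝ) : ℂ :=
  ∑' n : ℕ, (Polynomial.eval a (ascPochhammer ℂ n) /
    (Polynomial.eval c (ascPochhammer ℂ n) * (n.factorial : ℂ))) * (t : ℂ) ^ n

/-- The seed functions `φ_{i,j}`. -/
noncomputable def phiV (a c c₁ c₂ : ℂ) (i j : ℤ) (t : ℝ) : ℂ :=
  c₁ * (Complex.Gamma (a + i) * Complex.Gamma (c - a - i + j) / Complex.Gamma (c + j)) *
      kummerF (a + i) (c + j) t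
  + c₂ * (1 / (Complex.sin ((π : ℂ) * (c - a - i + j)) * Complex.Gamma (2 - c - j))) *
      ((t : ℂ) ^ (1 - c - (j : ℂ)) * kummerF (a - c + 1 + i - j) (2 - c - j) t)

/-- The Euler derivation `δ = t d/dt`. -/
noncomputable def eulerD (f : ℝ → ℂ) : ℝ → ℂ := fun t => (t : ℂ) * deriv f t

/-- The Hankel determinants `τ_n^{i,j} = det((t d/dt)^{k+l} φ_{i,j})_{0≤k,l≤n-1}`,
extended by `0` to negative indices `n`. -/
noncomputable def tauV (a c c₁ c₂ : ℂ) (i j : ℤ) (m : ℤ) (t : ℝ) : ℂ :=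
  if m < 0 then 0
  else Matrix.det (Matrix.of fun k l : Fin m.toNat =>
    eulerD^[(k : ℕ) + (l : ℕ)] (phiV a c c₁ c₂ i j) t)

open Polynomial in
/-- The linear functional on polynomials with moments `u`. -/
noncomputable def momentFunctional (u : ℕ → ℂ) : ℂ[X] →ₗ[ℂ] ℂ :=
  (Polynomial.basisMonomials ℂ).constr ℂ u

/-- The Hankel determinant of a sequence. -/
noncomputable def hankelDet (u : ℕ → ℂ) (n : ℕ) : ℂ :=
  Matrix.det (Matrix.of fun k l : Fin n => u (k + l))

/-- The Hankel determinant of a sequence with its last column shifted by one. -/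
noncomputable def hankelDetShift (u : ℕ → ℂ) (n : ℕ) : ℂ :=
  if n = 0 then 0 else
  Matrix.det (Matrix.of fun k l : Fin n => u (k + if (l : ℕ) + 1 = n then n else l))

open Polynomial in
/-- The (unnormalised) orthogonal polynomial of degree `n` of a moment sequence. -/
noncomputable def orthPoly (u : ℕ → ℂ) (n : ℕ) : ℂ[X] :=
  ∑ l : Fin (n + 1), monomial (l : ℕ)
    (Matrix.adjugate (Matrix.of fun k l : Fin (n + 1) => u (k + l)) (Fin.last n) l)

section Moments

open Polynomial

theorem momentFunctional_monomial (u : ℕ → ℂ) (k : ℕ) (x : ℂ) :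
    momentFunctional u (monomial k x) = x * u k := by
  have : monomial k x = x • Polynomial.basisMonomials ℂ k := by
    simp [Polynomial.coe_basisMonomials, smul_monomial]
  rw [this, map_smul, momentFunctional, Module.Basis.constr_basis, smul_eq_mul]

theorem momentFunctional_X_pow (u : ℕ → ℂ) (k : ℕ) : momentFunctional u (X ^ k) = u k := by
  rw [← monomial_one_right_eq_X_pow, momentFunctional_monomial, one_mul]

theorem momentFunctional_orthPoly_mul_X_pow (u : ℕ → ℂ) (n k : ℕ) :
    momentFunctional u (orthPoly u n * X ^ k) =
      Matrix.det ((Matrix.of fun k l : Fin (n + 1) => u (k + l)).updateCol (Fin.last n)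
        fun l => u (l + k)) := by
  rw [← Matrix.cramer_apply, Matrix.cramer_eq_adjugate_mulVec, orthPoly, Finset.sum_mul, map_sum]
  simp [Matrix.mulVec, dotProduct, monomial_mul_X_pow, momentFunctional_monomial]

theorem momentFunctional_orthPoly_mul_X_pow_of_lt (u : ℕ → ℂ) {n k : ℕ} (h : k < n) :
    momentFunctional u (orthPoly u n * X ^ k) = 0 := by
  rw [momentFunctional_orthPoly_mul_X_pow]
  refine Matrix.det_zero_of_column_eq (i := Fin.last n) (j := ⟨k, by omega⟩)
    (by simp [Fin.ext_iff]; omega) fun i => ?_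
  rw [Matrix.updateCol_self, Matrix.updateCol_ne (by simp [Fin.ext_iff]; omega)]
  simp

theorem momentFunctional_orthPoly_mul_X_pow_self (u : ℕ → ℂ) (n : ℕ) :
    momentFunctional u (orthPoly u n * X ^ n) = hankelDet u (n + 1) := by
  rw [momentFunctional_orthPoly_mul_X_pow, hankelDet]
  congr 1
  ext i j
  refine Fin.lastCases ?_ (fun j => ?_) j
  · simp
  · rw [Matrix.updateCol_ne (Fin.castSucc_lt_last j).ne]

theorem momentFunctional_orthPoly_mul_X_pow_succ (u : ℕ → ℂ) (n : ℕ) :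
    momentFunctional u (orthPoly u n * X ^ (n + 1)) = hankelDetShift u (n + 1) := by
  rw [momentFunctional_orthPoly_mul_X_pow, hankelDetShift, if_neg n.succ_ne_zero]
  congr 1
  ext i j
  refine Fin.lastCases ?_ (fun j => ?_) j
  · simp
  · rw [Matrix.updateCol_ne (Fin.castSucc_lt_last j).ne]
    simp [j.isLt.ne]

theorem momentFunctional_orthPoly_mul (u : ℕ → ℂ) {n : ℕ} {q : ℂ[X]} (hq : q.natDegree ≤ n + 1) :
    momentFunctional u (orthPoly u n * q) =
      q.coeff (n + 1) * hankelDetShift u (n + 1) + q.coeff n * hankelDet u (n + 1) := by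
  have h := q.as_sum_range_C_mul_X_pow' (n := n + 2) (by omega)
  have h2 : momentFunctional u (orthPoly u n * q) =
      ∑ k ∈ Finset.range (n + 2), q.coeff k * momentFunctional u (orthPoly u n * X ^ k) := by
    conv_lhs => rw [h]
    rw [Finset.mul_sum, map_sum]
    refine Finset.sum_congr rfl fun k _ => ?_
    rw [mul_left_comm, ← smul_eq_C_mul, map_smul, smul_eq_mul]
  rw [h2, Finset.sum_range_succ, Finset.sum_range_succ, Finset.sum_eq_zero,
    momentFunctional_orthPoly_mul_X_pow_self, momentFunctional_orthPoly_mul_X_pow_succ]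
  · ring
  · intro k hk
    rw [momentFunctional_orthPoly_mul_X_pow_of_lt u (Finset.mem_range.1 hk), mul_zero]

theorem coeff_orthPoly (u : ℕ → ℂ) {n : ℕ} (l : Fin (n + 1)) :
    (orthPoly u n).coeff l =
      Matrix.adjugate (Matrix.of fun k l : Fin (n + 1) => u (k + l)) (Fin.last n) l := by
  simp [orthPoly, coeff_monomial, Fin.val_inj]

theorem natDegree_orthPoly_le (u : ℕ → ℂ) (n : ℕ) : (orthPoly u n).natDegree ≤ n :=
  natDegree_sum_le_of_forall_le _ _ fun l _ => (natDegree_monomial_le _).trans (by omega)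

theorem coeff_orthPoly_self (u : ℕ → ℂ) (n : ℕ) : (orthPoly u n).coeff n = hankelDet u n := by
  have h := coeff_orthPoly u (Fin.last n)
  rw [Fin.val_last] at h
  rw [h, Matrix.adjugate_fin_succ_eq_det_submatrix, hankelDet, Even.neg_one_pow (by simp), one_mul]
  congr 1
  ext i j
  simp

theorem coeff_X_mul_orthPoly (u : ℕ → ℂ) (n : ℕ) :
    (X * orthPoly u n).coeff n = -hankelDetShift u n := by
  cases n with
  | zero => simp [hankelDetShift]
  | succ m =>
    rw [coeff_X_mul]
    have h := coeff_orthPoly u (n := m + 1) ⟨m, by omega⟩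
    simp only at h
    rw [h, Matrix.adjugate_fin_succ_eq_det_submatrix, hankelDetShift, if_neg m.succ_ne_zero,
      Odd.neg_one_pow (by simp only [Fin.val_last]; exact ⟨m, by ring⟩), neg_one_mul,
      ← Matrix.det_transpose]
    congr 2
    ext i j
    simp only [Matrix.transpose_apply, Matrix.submatrix_apply, Matrix.of_apply,
      Fin.succAbove_last, Fin.val_castSucc, add_comm (i : ℕ)]
    congr 2
    have := j.isLt
    simp only [Fin.succAbove, Fin.lt_def, Fin.val_castSucc]
    split_ifs <;> simp <;> omega

theorem coeff_taylor_of_natDegree_le {q : ℂ[X]} {n : ℕ} (hq : q.natDegree ≤ n) (r : ℂ) :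
    (taylor r q).coeff n = q.coeff n := by
  rw [taylor_coeff, hasseDeriv_apply, sum_over_range' _ _ (n + 1) (by omega)]
  · rw [Finset.sum_range_succ, Finset.sum_eq_zero]
    · simp
    · intro k hk
      simp [Nat.choose_eq_zero_of_lt (Finset.mem_range.1 hk)]
  · simp

theorem coeff_X_mul_taylor_of_natDegree_le {q : ℂ[X]} {n : ℕ} (hq : q.natDegree ≤ n) (r : ℂ) :
    (X * taylor r q).coeff n = (X * q).coeff n + n * r * q.coeff n := by
  cases n with
  | zero => simp
  | succ m =>
    rw [coeff_X_mul, coeff_X_mul, taylor_coeff, hasseDeriv_apply,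
      sum_over_range' _ _ (m + 2) (by omega)]
    · rw [Finset.sum_range_succ, Finset.sum_range_succ, Finset.sum_eq_zero]
      · simp
        ring
      · intro k hk
        simp [Nat.choose_eq_zero_of_lt (Finset.mem_range.1 hk)]
    · simp

theorem hankelDet_identity {u v : ℕ → ℂ} {a c t : ℂ}
    (h₁ : ∀ k, v (k + 1) + c * v k = u (k + 1) + a * u k)
    (h₂ : ∀ k, u (k + 1) = t * ∑ j ∈ Finset.range (k + 1), (k.choose j) * v j) (n : ℕ) :
    (a + n) * (hankelDet u (n + 1) * hankelDet v n) =
      hankelDet u n * hankelDetShift v (n + 1) - hankelDetShift u n * hankelDet v (n + 1)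
        + (c - t) * (hankelDet u n * hankelDet v (n + 1)) := by
  have e₁ : ∀ p : ℂ[X], momentFunctional v ((X + C c) * p) = momentFunctional u ((X + C a) * p) := by
    intro p
    induction p using Polynomial.induction_on' with
    | add p q hp hq => rw [mul_add, mul_add, map_add, map_add, hp, hq]
    | monomial k x =>
      simp only [add_mul, X_mul_monomial, C_mul_monomial, map_add, momentFunctional_monomial]
      linear_combination x * h₁ k
  have e₂ : ∀ p : ℂ[X], momentFunctional u (X * p) = t * momentFunctional v (taylor 1 p) := by
    intro p
    induction p using Polynomial.induction_on' with
    | add p q hp hq => rw [mul_add, map_add, map_add, map_add, hp, hq, mul_add]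
    | monomial k x =>
      rw [X_mul_monomial, momentFunctional_monomial, taylor_monomial, h₂, C_1, add_pow,
        ← smul_eq_C_mul, map_smul, map_sum, smul_eq_mul]
      have : ∀ j ∈ Finset.range (k + 1), momentFunctional v (X ^ j * 1 ^ (k - j) * (k.choose j : ℂ[X]))
          = (k.choose j) * v j := by
        intro j _
        rw [one_pow, mul_one, mul_comm, ← C_eq_natCast, ← smul_eq_C_mul, map_smul,
          momentFunctional_X_pow, smul_eq_mul]
      rw [Finset.sum_congr rfl this]
      ring
  set p := orthPoly u n with hp
  set q := orthPoly v n with hq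
  have dp : p.natDegree ≤ n := natDegree_orthPoly_le u n
  have dq : q.natDegree ≤ n := natDegree_orthPoly_le v n
  have lin : ∀ (r : ℂ[X]) (x : ℂ), r.natDegree ≤ n → ((X + C x) * r).natDegree ≤ n + 1 := by
    intro r x hr
    refine natDegree_mul_le.trans ?_
    have := natDegree_X_add_C x
    omega
  have cl : ∀ (r : ℂ[X]) (x : ℂ), r.natDegree ≤ n → ((X + C x) * r).coeff (n + 1) = r.coeff n ∧
      ((X + C x) * r).coeff n = (X * r).coeff n + x * r.coeff n := by
    intro r x hr
    rw [add_mul, coeff_add, coeff_add, coeff_C_mul, coeff_C_mul, coeff_X_mul,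
      coeff_eq_zero_of_natDegree_lt (n := n + 1) (by omega)]
    simp
  have A₁ : momentFunctional v (q * ((X + C c) * p)) = momentFunctional u (p * ((X + C a) * q)) := by
    rw [mul_left_comm, e₁, mul_left_comm p, mul_comm p q]
  rw [momentFunctional_orthPoly_mul v (lin p c dp), momentFunctional_orthPoly_mul u (lin q a dq),
    (cl p c dp).1, (cl p c dp).2, (cl q a dq).1, (cl q a dq).2, coeff_orthPoly_self,
    coeff_orthPoly_self, coeff_X_mul_orthPoly, coeff_X_mul_orthPoly] at A₁
  have A₂ : momentFunctional u (p * (X * taylor (-1) q)) =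
      t * momentFunctional v (q * taylor 1 p) := by
    rw [mul_left_comm, e₂, taylor_mul, taylor_taylor]
    simp [mul_comm]
  have dq' : (X * taylor (-1) q).natDegree ≤ n + 1 := by
    have := natDegree_taylor q (-1)
    refine natDegree_mul_le.trans ?_
    rw [natDegree_X]
    omega
  have dp' : (taylor 1 p).natDegree ≤ n := (natDegree_taylor p 1).le.trans dp
  rw [momentFunctional_orthPoly_mul u dq', momentFunctional_orthPoly_mul v (dp'.trans n.le_succ),
    coeff_X_mul, coeff_X_mul_taylor_of_natDegree_le dq, coeff_taylor_of_natDegree_le dq,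
    coeff_taylor_of_natDegree_le dp, coeff_eq_zero_of_natDegree_lt (n := n + 1) (by omega),
    coeff_orthPoly_self, coeff_orthPoly_self, coeff_X_mul_orthPoly] at A₂
  linear_combination -A₁ - A₂

end Moments

section EulerDerivation

open scoped ContDiff

theorem hasDerivAt_matrix_det {n : ℕ} {M : ℝ → Matrix (Fin n) (Fin n) ℂ}
    {M' : Matrix (Fin n) (Fin n) ℂ} {s : ℝ}
    (h : ∀ i j, HasDerivAt (fun x => M x i j) (M' i j) s) :
    HasDerivAt (fun x => (M x).det) (∑ j, ((M s).updateCol j fun i => M' i j).det) s := by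
  simp only [Matrix.det_apply']
  rw [Finset.sum_comm]
  refine HasDerivAt.fun_sum fun σ _ => ?_
  rw [← Finset.mul_sum]
  refine HasDerivAt.const_mul _ ?_
  have := HasDerivAt.fun_finsetProd (u := Finset.univ) (fun i _ => h (σ i) i)
  refine this.congr_deriv (Finset.sum_congr rfl fun j _ => ?_)
  rw [← Finset.prod_erase_mul _ _ (Finset.mem_univ j), Matrix.updateCol_self, smul_eq_mul]
  congr 1
  refine Finset.prod_congr rfl fun i hi => ?_
  rw [Matrix.updateCol_ne (Finset.ne_of_mem_erase hi)]

theorem hasDerivAt_hankelDet {u : ℕ → ℝ → ℂ} {s : ℝ} {r : ℂ}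
    (h : ∀ k, HasDerivAt (u k) (r * u (k + 1) s) s) (n : ℕ) :
    HasDerivAt (fun x => hankelDet (fun k => u k x) n)
      (r * hankelDetShift (fun k => u k s) n) s := by
  have := hasDerivAt_matrix_det (n := n) (M := fun x => Matrix.of fun k l : Fin n => u (k + l) x)
    (M' := Matrix.of fun k l : Fin n => r * u (k + l + 1) s) (s := s) (fun i j => h _)
  refine this.congr_deriv ?_
  have hcol : ∀ j : Fin n, (fun i : Fin n =>
      (Matrix.of fun k l : Fin n => r * u (k + l + 1) s) i j) =
        r • fun i : Fin n => u (i + j + 1) s := fun j => rfl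
  simp_rw [hcol, Matrix.det_updateCol_smul, ← Finset.mul_sum]
  congr 1
  cases n with
  | zero => simp [hankelDetShift]
  | succ m =>
    rw [Fin.sum_univ_castSucc, Finset.sum_eq_zero, zero_add, hankelDetShift,
      if_neg m.succ_ne_zero]
    · congr 1
      ext i j
      refine Fin.lastCases ?_ (fun j => ?_) j
      · simp [add_assoc]
      · rw [Matrix.updateCol_ne (Fin.castSucc_lt_last j).ne]
        simp [j.isLt.ne]
    · intro j _
      refine Matrix.det_zero_of_column_eq (i := j.castSucc) (j := j.succ)
        (Fin.castSucc_lt_succ).ne fun i => ?_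
      rw [Matrix.updateCol_self, Matrix.updateCol_ne (Fin.castSucc_lt_succ).ne']
      simp [add_assoc]

theorem iteratedDeriv_ofReal_exp (k : ℕ) :
    iteratedDeriv k (fun s : ℝ => (Real.exp s : ℂ)) = fun s : ℝ => (Real.exp s : ℂ) := by
  induction k with
  | zero => simp
  | succ k ih =>
    rw [iteratedDeriv_succ, ih]
    ext s
    exact (Real.hasDerivAt_exp s).ofReal_comp.deriv

theorem contDiffOn_eulerD {f : ℝ → ℂ} (hf : ContDiffOn ℝ ∞ f (Set.Ioi 0)) :
    ContDiffOn ℝ ∞ (eulerD f) (Set.Ioi 0) :=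
  (Complex.ofRealCLM.contDiff.contDiffOn).mul
    ((contDiffOn_infty_iff_deriv_of_isOpen isOpen_Ioi).1 hf).2

theorem differentiableAt_of_contDiffOn {f : ℝ → ℂ} (hf : ContDiffOn ℝ ∞ f (Set.Ioi 0)) {t : ℝ}
    (ht : 0 < t) : DifferentiableAt ℝ f t :=
  (hf.contDiffAt (Ioi_mem_nhds ht)).differentiableAt (by simp)

theorem contDiff_comp_exp {f : ℝ → ℂ} (hf : ContDiffOn ℝ ∞ f (Set.Ioi 0)) :
    ContDiff ℝ ∞ (fun s => f (Real.exp s)) :=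
  contDiffOn_univ.1 (hf.comp Real.contDiff_exp.contDiffOn fun s _ => Real.exp_pos s)

theorem deriv_comp_exp {f : ℝ → ℂ} (hf : ContDiffOn ℝ ∞ f (Set.Ioi 0)) :
    deriv (fun s => f (Real.exp s)) = fun s => eulerD f (Real.exp s) := by
  ext s
  have := (differentiableAt_of_contDiffOn hf (Real.exp_pos s)).hasDerivAt.scomp s
    (Real.hasDerivAt_exp s)
  rw [eulerD, ← Complex.real_smul]
  exact this.deriv

theorem iterate_eulerD_exp {f : ℝ → ℂ} (hf : ContDiffOn ℝ ∞ f (Set.Ioi 0)) (k : ℕ) (s : ℝ) :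
    eulerD^[k] f (Real.exp s) = iteratedDeriv k (fun s => f (Real.exp s)) s := by
  induction k generalizing f with
  | zero => simp
  | succ k ih =>
    rw [Function.iterate_succ_apply, ih (contDiffOn_eulerD hf), iteratedDeriv_succ',
      deriv_comp_exp hf]

theorem mul_deriv_hankelDet_iterate_eulerD {f : ℝ → ℂ} (hf : ContDiffOn ℝ ∞ f (Set.Ioi 0)) (n : ℕ)
    {t : ℝ} (ht : 0 < t) :
    t * deriv (fun t => hankelDet (fun k => eulerD^[k] f t) n) t =
      hankelDetShift (fun k => eulerD^[k] f t) n := by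
  have hd : ∀ k, HasDerivAt (eulerD^[k] f) ((t : ℂ)⁻¹ * eulerD^[k + 1] f t) t := by
    intro k
    have hk : ContDiffOn ℝ ∞ (eulerD^[k] f) (Set.Ioi 0) := by
      induction k with
      | zero => exact hf
      | succ k ih => rw [Function.iterate_succ_apply']; exact contDiffOn_eulerD ih
    rw [Function.iterate_succ_apply', eulerD, inv_mul_cancel_left₀ (by exact_mod_cast ht.ne')]
    exact (differentiableAt_of_contDiffOn hk ht).hasDerivAt
  rw [(hasDerivAt_hankelDet hd n).deriv, mul_inv_cancel_left₀ (by exact_mod_cast ht.ne')]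

theorem iterate_eulerD_relations {f g : ℝ → ℂ} {a c : ℂ} (hf : ContDiffOn ℝ ∞ f (Set.Ioi 0))
    (hg : ContDiffOn ℝ ∞ g (Set.Ioi 0)) (h₁ : ∀ t, 0 < t → eulerD f t = t * g t)
    (h₂ : ∀ t, 0 < t → eulerD g t + c * g t = eulerD f t + a * f t) {t : ℝ} (ht : 0 < t) (k : ℕ) :
    eulerD^[k + 1] g t + c * eulerD^[k] g t = eulerD^[k + 1] f t + a * eulerD^[k] f t ∧
    eulerD^[k + 1] f t = t * ∑ j ∈ Finset.range (k + 1), (k.choose j) * eulerD^[j] g t := by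
  obtain ⟨s, rfl⟩ : ∃ s, Real.exp s = t := ⟨Real.log t, Real.exp_log ht⟩
  simp only [iterate_eulerD_exp hf, iterate_eulerD_exp hg]
  have cf := contDiff_comp_exp hf
  have cg := contDiff_comp_exp hg
  have cf' := contDiff_comp_exp (contDiffOn_eulerD hf)
  have cg' := contDiff_comp_exp (contDiffOn_eulerD hg)
  set F := fun s => f (Real.exp s)
  set G := fun s => g (Real.exp s)
  have hk : ((k : ℕ∞) : WithTop ℕ∞) ≤ ∞ := by exact_mod_cast le_top
  have eF := deriv_comp_exp hf
  have eG := deriv_comp_exp hg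
  rw [← eF] at cf'
  rw [← eG] at cg'
  constructor
  · have h : (deriv G + fun s => c * G s) = deriv F + fun s => a * F s := by
      rw [eF, eG]
      ext s
      exact h₂ _ (Real.exp_pos s)
    have := congrArg (fun h => iteratedDeriv k h s) h
    rw [iteratedDeriv_add, iteratedDeriv_add, iteratedDeriv_const_mul, iteratedDeriv_const_mul,
      ← iteratedDeriv_succ', ← iteratedDeriv_succ'] at this
    · exact this
    all_goals exact (ContDiff.of_le (by first | assumption | exact contDiff_const.mul ‹_›) hk).contDiffAt
  · have h : deriv F = fun s => (Real.exp s : ℂ) * G s := by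
      rw [eF]
      ext s
      exact h₁ _ (Real.exp_pos s)
    have ce : ContDiff ℝ ∞ (fun s : ℝ => (Real.exp s : ℂ)) :=
      Complex.ofRealCLM.contDiff.comp Real.contDiff_exp
    rw [iteratedDeriv_succ', h, iteratedDeriv_fun_mul (ce.of_le hk).contDiffAt
      (cg.of_le hk).contDiffAt, ← Finset.sum_range_reflect, Finset.mul_sum]
    refine Finset.sum_congr rfl fun j hj => ?_
    have hj : j ≤ k := Nat.lt_succ_iff.1 (Finset.mem_range.1 hj)
    rw [Nat.add_sub_cancel, Nat.sub_sub_self hj, Nat.choose_symm hj, iteratedDeriv_ofReal_exp]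
    ring

end EulerDerivation

/-- The coefficients of Kummer's series. -/
noncomputable def kummerCoeff (a c : ℂ) (n : ℕ) : ℂ :=
  Polynomial.eval a (ascPochhammer ℂ n) /
    (Polynomial.eval c (ascPochhammer ℂ n) * (n.factorial : ℂ))

section Kummer

open Filter Topology
open scoped ContDiff

theorem ascPochhammer_eval_succ_left (a : ℂ) (n : ℕ) :
    (ascPochhammer ℂ (n + 1)).eval a = a * (ascPochhammer ℂ n).eval (a + 1) := by
  simp [ascPochhammer_succ_left]

theorem ascPochhammer_eval_ne_zero {c : ℂ} (hc : ∀ m : ℕ, c + m ≠ 0) (n : ℕ) :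
    (ascPochhammer ℂ n).eval c ≠ 0 := by
  induction n with
  | zero => simp
  | succ n ih => rw [ascPochhammer_succ_eval]; exact mul_ne_zero ih (hc n)

theorem add_one_add_natCast_ne_zero {c : ℂ} (hc : ∀ m : ℕ, c + m ≠ 0) (m : ℕ) : c + 1 + m ≠ 0 := by
  have := hc (m + 1)
  push_cast at this
  rwa [add_assoc, add_comm 1 (m : ℂ)]

theorem add_mul_ascPochhammer_eval (a : ℂ) (n : ℕ) :
    (a + n) * (ascPochhammer ℂ n).eval a = a * (ascPochhammer ℂ n).eval (a + 1) := by
  rw [← ascPochhammer_eval_succ_left, ascPochhammer_succ_eval, mul_comm]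

theorem kummerCoeff_succ {c : ℂ} (hc : ∀ m : ℕ, c + m ≠ 0) (a : ℂ) (n : ℕ) :
    kummerCoeff a c (n + 1) = (a + n) / ((c + n) * (n + 1)) * kummerCoeff a c n := by
  have h1 := ascPochhammer_eval_ne_zero hc n
  have h2 := hc n
  have h3 : (n : ℂ) + 1 ≠ 0 := n.cast_add_one_ne_zero
  have h4 : (n.factorial : ℂ) ≠ 0 := by exact_mod_cast n.factorial_ne_zero
  rw [kummerCoeff, kummerCoeff, ascPochhammer_succ_eval, ascPochhammer_succ_eval,
    Nat.factorial_succ]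
  push_cast
  field_simp

theorem succ_mul_kummerCoeff_succ {c : ℂ} (hc : ∀ m : ℕ, c + m ≠ 0) (a : ℂ) (n : ℕ) :
    (n + 1) * kummerCoeff a c (n + 1) = a / c * kummerCoeff (a + 1) (c + 1) n := by
  have h1 := ascPochhammer_eval_ne_zero (add_one_add_natCast_ne_zero hc) n
  have h2 : c ≠ 0 := by simpa using hc 0
  have h3 : (n : ℂ) + 1 ≠ 0 := n.cast_add_one_ne_zero
  have h4 : (n.factorial : ℂ) ≠ 0 := by exact_mod_cast n.factorial_ne_zero
  rw [kummerCoeff, kummerCoeff, ascPochhammer_eval_succ_left, ascPochhammer_eval_succ_left,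
    Nat.factorial_succ]
  push_cast
  field_simp

theorem add_mul_kummerCoeff_bottom {d : ℂ} (hd : ∀ m : ℕ, d + m ≠ 0) (b : ℂ) (n : ℕ) :
    (n + d) * kummerCoeff b (d + 1) n = d * kummerCoeff b d n := by
  have h1 := ascPochhammer_eval_ne_zero (add_one_add_natCast_ne_zero hd) n
  have h2 := ascPochhammer_eval_ne_zero hd n
  have h4 : (n.factorial : ℂ) ≠ 0 := by exact_mod_cast n.factorial_ne_zero
  have := add_mul_ascPochhammer_eval d n
  rw [kummerCoeff, kummerCoeff]
  field_simp
  linear_combination (ascPochhammer ℂ n).eval b * this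

theorem add_mul_kummerCoeff_top (a c : ℂ) (n : ℕ) :
    (n + a) * kummerCoeff a c n = a * kummerCoeff (a + 1) c n := by
  have := add_mul_ascPochhammer_eval a n
  rw [kummerCoeff, kummerCoeff, ← mul_div_assoc, ← mul_div_assoc, ← this, add_comm (n : ℂ)]

theorem summable_kummerCoeff {c : ℂ} (hc : ∀ m : ℕ, c + m ≠ 0) (a z : ℂ) :
    Summable fun n => kummerCoeff a c n * z ^ n := by
  have h1 : Tendsto (fun n : ℕ => (a + 1 * n) / (c + 1 * n)) atTop (𝓝 (1 / 1)) :=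
    tendsto_add_mul_div_add_mul_atTop_nhds a c 1 one_ne_zero
  have h2 : Tendsto (fun n : ℕ => z * (1 / ((n : ℂ) + 1))) atTop (𝓝 (z * 0)) :=
    tendsto_one_div_add_atTop_nhds_zero_nat.const_mul z
  have h3 := (h1.mul h2).norm
  simp only [mul_zero, norm_zero, one_mul] at h3
  have h4 := h3.eventually_le_const (show (0 : ℝ) < 1 / 2 by norm_num)
  refine summable_of_ratio_norm_eventually_le (r := 1 / 2) (by norm_num) ?_
  filter_upwards [h4] with n hn
  have : kummerCoeff a c (n + 1) * z ^ (n + 1) =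
      ((a + n) / (c + n) * (z * (1 / ((n : ℂ) + 1)))) * (kummerCoeff a c n * z ^ n) := by
    rw [kummerCoeff_succ hc]
    have := hc n
    have h3 : (n : ℂ) + 1 ≠ 0 := n.cast_add_one_ne_zero
    field_simp
    ring
  rw [this, norm_mul]
  gcongr

theorem hasSum_kummerF {c : ℂ} (hc : ∀ m : ℕ, c + m ≠ 0) (a : ℂ) (t : ℝ) :
    HasSum (fun n => kummerCoeff a c n * (t : ℂ) ^ n) (kummerF a c t) :=
  (summable_kummerCoeff hc a t).hasSum

theorem hasDerivAt_kummerF {c : ℂ} (hc : ∀ m : ℕ, c + m ≠ 0) (a : ℂ) (t : ℝ) :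
    HasDerivAt (kummerF a c) (a / c * kummerF (a + 1) (c + 1) t) t := by
  have hs := (summable_kummerCoeff hc a (‖(t : ℂ)‖ + 1 : ℝ)).norm
  have hF : ∀ n : ℕ, DifferentiableOn ℂ (fun z : ℂ => kummerCoeff a c n * z ^ n)
      (Metric.ball 0 (‖(t : ℂ)‖ + 1)) := fun n => by fun_prop
  have hb : ∀ (n : ℕ) (w : ℂ), w ∈ Metric.ball (0 : ℂ) (‖(t : ℂ)‖ + 1) →
      ‖kummerCoeff a c n * w ^ n‖ ≤ ‖kummerCoeff a c n * ((‖(t : ℂ)‖ + 1 : ℝ) : ℂ) ^ n‖ := by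
    intro n w hw
    rw [mem_ball_zero_iff] at hw
    rw [norm_mul, norm_mul, norm_pow, norm_pow, Complex.norm_real,
      Real.norm_of_nonneg (r := ‖(t : ℂ)‖ + 1) (by positivity)]
    gcongr
  have ht : (t : ℂ) ∈ Metric.ball (0 : ℂ) (‖(t : ℂ)‖ + 1) := by simp
  have hd := (Complex.differentiableOn_tsum_of_summable_norm hs hF Metric.isOpen_ball hb).differentiableAt
    (Metric.isOpen_ball.mem_nhds ht)
  have hsum := Complex.hasSum_deriv_of_summable_norm hs hF Metric.isOpen_ball hb ht
  have hD := hd.hasDerivAt.comp_ofReal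
  refine hD.congr_deriv (hsum.unique ?_)
  rw [← hasSum_nat_add_iff' 1]
  have := (hasSum_kummerF (add_one_add_natCast_ne_zero hc) (a + 1) t).mul_left (a / c)
  convert! this using 1
  · ext n
    have h := succ_mul_kummerCoeff_succ hc a n
    simp only [deriv_const_mul_field, deriv_pow_field, Nat.add_sub_cancel]
    push_cast
    linear_combination (t : ℂ) ^ n * h
  · simp

theorem contDiff_kummerF (n : ℕ) {c : ℂ} (hc : ∀ m : ℕ, c + m ≠ 0) (a : ℂ) :
    ContDiff ℝ n (kummerF a c) := by
  induction n generalizing a c with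
  | zero =>
    exact contDiff_zero.2 (continuous_iff_continuousAt.2 fun t =>
      (hasDerivAt_kummerF hc a t).continuousAt)
  | succ n ih =>
    have : ((n + 1 : ℕ) : WithTop ℕ∞) = (n : WithTop ℕ∞) + 1 := by push_cast; rfl
    rw [this, contDiff_succ_iff_deriv]
    refine ⟨fun t => (hasDerivAt_kummerF hc a t).differentiableAt, by simp, ?_⟩
    rw [funext fun t => (hasDerivAt_kummerF hc a t).deriv]
    exact contDiff_const.mul (ih (add_one_add_natCast_ne_zero hc) (a + 1))

theorem hasSum_mul_deriv_kummerF {c : ℂ} (hc : ∀ m : ℕ, c + m ≠ 0) (a : ℂ) (t : ℝ) :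
    HasSum (fun n : ℕ => n * kummerCoeff a c n * (t : ℂ) ^ n)
      (t * deriv (kummerF a c) t) := by
  rw [← hasSum_nat_add_iff' 1, (hasDerivAt_kummerF hc a t).deriv]
  convert! ((hasSum_kummerF (add_one_add_natCast_ne_zero hc) (a + 1) t).mul_left
    (t * (a / c))) using 1
  · ext n
    have h := succ_mul_kummerCoeff_succ hc a n
    push_cast
    linear_combination (t : ℂ) ^ (n + 1) * h
  · simp [mul_assoc]

theorem mul_deriv_kummerF_add_bottom {d : ℂ} (hd : ∀ m : ℕ, d + m ≠ 0) (b : ℂ) (t : ℝ) :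
    t * deriv (kummerF b (d + 1)) t + d * kummerF b (d + 1) t = d * kummerF b d t := by
  have hd' := add_one_add_natCast_ne_zero hd
  refine ((hasSum_mul_deriv_kummerF hd' b t).add ((hasSum_kummerF hd' b t).mul_left d)).unique ?_
  convert! (hasSum_kummerF hd b t).mul_left d using 1
  ext n
  linear_combination (t : ℂ) ^ n * add_mul_kummerCoeff_bottom hd b n

theorem mul_deriv_kummerF_add_top {c : ℂ} (hc : ∀ m : ℕ, c + m ≠ 0) (a : ℂ) (t : ℝ) :
    t * deriv (kummerF a c) t + a * kummerF a c t = a * kummerF (a + 1) c t := by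
  refine ((hasSum_mul_deriv_kummerF hc a t).add ((hasSum_kummerF hc a t).mul_left a)).unique ?_
  convert! (hasSum_kummerF hc (a + 1) t).mul_left a using 1
  ext n
  linear_combination (t : ℂ) ^ n * add_mul_kummerCoeff_top a c n

theorem contDiffOn_ofReal_cpow (x : ℂ) : ContDiffOn ℝ ∞ (fun t : ℝ => (t : ℂ) ^ x) (Set.Ioi 0) := by
  have h : ContDiffOn ℝ ∞ (fun t : ℝ => Complex.exp ((Real.log t : ℂ) * x)) (Set.Ioi 0) := by
    refine ContDiffOn.cexp (ContDiffOn.mul ?_ contDiffOn_const)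
    exact Complex.ofRealCLM.contDiff.comp_contDiffOn
      (Real.contDiffOn_log.mono fun t ht => (ne_of_gt ht : t ≠ 0))
  refine h.congr fun t ht => ?_
  rw [Complex.cpow_def_of_ne_zero (by exact_mod_cast (ne_of_gt ht : t ≠ 0)),
    Complex.ofReal_log (le_of_lt ht)]

theorem add_natCast_ne_zero_of_notMem {c : ℂ} (hc : c ∉ Set.range ((↑·) : ℤ → ℂ)) (k : ℤ) (m : ℕ) :
    c + k + m ≠ 0 := by
  intro h
  refine hc ⟨-k - m, ?_⟩
  push_cast
  linear_combination -h

theorem sub_natCast_ne_zero_of_notMem {c : ℂ} (hc : c ∉ Set.range ((↑·) : ℤ → ℂ)) (k : ℤ) (m : ℕ) :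
    k - c + m ≠ 0 := by
  intro h
  refine hc ⟨k + m, ?_⟩
  push_cast
  linear_combination h

theorem contDiffOn_phiV {a c : ℂ} (c₁ c₂ : ℂ) (hc : c ∉ Set.range ((↑·) : ℤ → ℂ)) (i j : ℤ) :
    ContDiffOn ℝ ∞ (phiV a c c₁ c₂ i j) (Set.Ioi 0) := by
  have h : ∀ m : ℕ, 2 - c - j + m ≠ 0 := fun m => by
    have := sub_natCast_ne_zero_of_notMem hc (2 - j) m
    push_cast at this
    rwa [sub_right_comm]
  exact (contDiffOn_const.mul (contDiff_infty.2 fun n =>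
      contDiff_kummerF n (add_natCast_ne_zero_of_notMem hc j) _).contDiffOn).add
    (contDiffOn_const.mul ((contDiffOn_ofReal_cpow _).mul
      (contDiff_infty.2 fun n => contDiff_kummerF n h _).contDiffOn))

theorem phiV_zero_zero (a c c₁ c₂ : ℂ) :
    phiV a c c₁ c₂ 0 0 = fun t : ℝ =>
      c₁ * (Complex.Gamma a * Complex.Gamma (c - a) / Complex.Gamma c) * kummerF a c t +
      c₂ * (1 / (Complex.sin (π * (c - a)) * Complex.Gamma (1 - c + 1))) *
        ((t : ℂ) ^ (1 - c) * kummerF (a - c + 1) (1 - c + 1) t) := by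
  ext t
  have : (2 : ℂ) - c = 1 - c + 1 := by ring
  simp [phiV, this]

theorem phiV_one_one {a c : ℂ} (c₁ c₂ : ℂ) (ha : a ≠ 0) (hc₀ : c ≠ 0) (hc₁ : 1 - c ≠ 0) :
    phiV a c c₁ c₂ 1 1 = fun t : ℝ =>
      c₁ * (Complex.Gamma a * Complex.Gamma (c - a) / Complex.Gamma c) *
        (a / c * kummerF (a + 1) (c + 1) t) +
      c₂ * (1 / (Complex.sin (π * (c - a)) * Complex.Gamma (1 - c + 1))) *
        ((1 - c) * ((t : ℂ) ^ (-c) * kummerF (a - c + 1) (1 - c) t)) := by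
  ext t
  have e₁ : (2 : ℂ) - c - 1 = 1 - c := by ring
  have e₂ : 1 - c - 1 = -c := by ring
  have e₃ : a - c + 1 + 1 - 1 = a - c + 1 := by ring
  simp only [phiV, Int.cast_one, sub_add_cancel, e₁, e₂, e₃, Complex.Gamma_add_one _ ha,
    Complex.Gamma_add_one _ hc₀, Complex.Gamma_add_one _ hc₁]
  congr 1
  · rw [mul_assoc a, mul_div_mul_comm]
    ring
  · rw [mul_left_comm (Complex.sin _), one_div, one_div, mul_inv (1 - c)]
    field_simp

theorem phiV_relations {a c : ℂ} (c₁ c₂ : ℂ) (ha : a ≠ 0)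
    (hc : c ∉ Set.range ((↑·) : ℤ → ℂ)) {t : ℝ} (ht : 0 < t) :
    eulerD (phiV a c c₁ c₂ 0 0) t = t * phiV a c c₁ c₂ 1 1 t ∧
    eulerD (phiV a c c₁ c₂ 1 1) t + c * phiV a c c₁ c₂ 1 1 t =
      eulerD (phiV a c c₁ c₂ 0 0) t + a * phiV a c c₁ c₂ 0 0 t := by
  have hc' : ∀ m : ℕ, c + m ≠ 0 := by simpa using add_natCast_ne_zero_of_notMem hc 0
  have hd : ∀ m : ℕ, 1 - c + m ≠ 0 := by simpa using sub_natCast_ne_zero_of_notMem hc 1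
  have hc₀ : c ≠ 0 := by simpa using hc' 0
  have hc₁ : 1 - c ≠ 0 := by simpa using hd 0
  have ht' : (t : ℂ) ≠ 0 := by exact_mod_cast ht.ne'
  have hc'' := add_one_add_natCast_ne_zero hc'
  have hd' := add_one_add_natCast_ne_zero hd
  rw [phiV_one_one c₁ c₂ ha hc₀ hc₁, phiV_zero_zero]
  generalize c₁ * (Complex.Gamma a * Complex.Gamma (c - a) / Complex.Gamma c) = α
  generalize c₂ * (1 / (Complex.sin (π * (c - a)) * Complex.Gamma (1 - c + 1))) = β
  set b := a - c + 1 with hb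
  have dx := hasDerivAt_ofReal_cpow_const ht.ne' hc₁
  have dy := hasDerivAt_ofReal_cpow_const ht.ne' (neg_ne_zero.2 hc₀)
  have ex : (t : ℂ) ^ (1 - c) = t * (t : ℂ) ^ (-c) := by
    rw [sub_eq_add_neg, Complex.cpow_add _ _ ht', Complex.cpow_one]
  have ey : (t : ℂ) ^ (-c) = t * (t : ℂ) ^ (-c - 1) := by
    rw [Complex.cpow_sub _ _ ht', Complex.cpow_one, mul_div_cancel₀ _ ht']
  rw [show 1 - c - 1 = -c by ring] at dx
  have k₁ := hasDerivAt_kummerF hc' a t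
  have k₂ := (hasDerivAt_kummerF hc'' (a + 1) t).differentiableAt.hasDerivAt
  have k₃ := (hasDerivAt_kummerF hd' b t).differentiableAt.hasDerivAt
  have k₄ := (hasDerivAt_kummerF hd b t).differentiableAt.hasDerivAt
  have D₀ : HasDerivAt (fun t : ℝ => α * kummerF a c t +
      β * ((t : ℂ) ^ (1 - c) * kummerF b (1 - c + 1) t)) _ t :=
    (k₁.const_mul α).add ((dx.mul k₃).const_mul β)
  have D₁ : HasDerivAt (fun t : ℝ => α * (a / c * kummerF (a + 1) (c + 1) t) +
      β * ((1 - c) * ((t : ℂ) ^ (-c) * kummerF b (1 - c) t))) _ t :=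
    ((k₂.const_mul (a / c)).const_mul α).add (((dy.mul k₄).const_mul (1 - c)).const_mul β)
  have r₁ := mul_deriv_kummerF_add_bottom hc' (a + 1) t
  have r₂ := mul_deriv_kummerF_add_top hc' a t
  rw [k₁.deriv] at r₂
  have r₃ := mul_deriv_kummerF_add_bottom hd b t
  have r₄ := mul_deriv_kummerF_add_top hd' b t
  have r₅ : (1 - c) * deriv (kummerF b (1 - c)) t = b * kummerF (b + 1) (1 - c + 1) t := by
    rw [(hasDerivAt_kummerF hd b t).deriv]
    field_simp
  have r₆ : a / c * (c * kummerF (a + 1) c t) = a * kummerF (a + 1) c t := by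
    field_simp
  simp only [eulerD]
  rw [D₀.deriv, D₁.deriv, ex]
  constructor
  · linear_combination β * t * (t : ℂ) ^ (-c) * r₃
  · linear_combination α * (a / c * r₁ - r₂ + r₆) + β * t * (t : ℂ) ^ (-c) * (r₅ - r₄) +
      β * (1 - c) * c * kummerF b (1 - c) t * ey +
      β * t * (t : ℂ) ^ (-c) * kummerF b (1 - c + 1) t * hb

end Kummer

/-- the identity
`(a+n) τ_{n+1}^{0,0} τ_n^{1,1} / (τ_n^{0,0} τ_{n+1}^{1,1})
  = t (d/dt) log(τ_{n+1}^{1,1}/τ_n^{0,0}) + c - t`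
(equivalently `(a+n)√t/f₁ = t (d/dt) log(τ_{n+1}^{1,1}/τ_n^{0,0}) + c - t`). -/
theorem pV_log_derivative_identity
    (a c c₁ c₂ : ℂ)
    (ha : a ∉ Set.range ((↑·) : ℤ → ℂ))
    (hc : c ∉ Set.range ((↑·) : ℤ → ℂ))
    (hca : c - a ∉ Set.range ((↑·) : ℤ → ℂ))
    (n : ℕ) :
    ∀ t : ℝ, 0 < t →
      tauV a c c₁ c₂ 0 0 n t ≠ 0 →
      tauV a c c₁ c₂ 1 1 (n + 1) t ≠ 0 →
      (a + n) * (tauV a c c₁ c₂ 0 0 (n + 1) t * tauV a c c₁ c₂ 1 1 n t) /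
          (tauV a c c₁ c₂ 0 0 n t * tauV a c c₁ c₂ 1 1 (n + 1) t) =
        (t : ℂ) * (deriv (tauV a c c₁ c₂ 1 1 (n + 1)) t / tauV a c c₁ c₂ 1 1 (n + 1) t
            - deriv (tauV a c c₁ c₂ 0 0 n) t / tauV a c c₁ c₂ 0 0 n t)
          + c - (t : ℂ) := by
  intro t ht h₀ h₁
  have hτ : ∀ (i j : ℤ) (m : ℕ), tauV a c c₁ c₂ i j m =
      fun t => hankelDet (fun k => eulerD^[k] (phiV a c c₁ c₂ i j) t) m := fun i j m => by
    ext t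
    simp [tauV, hankelDet]
  have hn : ((n : ℤ) + 1) = ((n + 1 : ℕ) : ℤ) := by push_cast; rfl
  have ha₀ : a ≠ 0 := fun h => ha ⟨0, by simp [h]⟩
  have s₀ := contDiffOn_phiV (a := a) c₁ c₂ hc 0 0
  have s₁ := contDiffOn_phiV (a := a) c₁ c₂ hc 1 1
  have hr := fun k => iterate_eulerD_relations s₀ s₁
    (fun t ht => (phiV_relations c₁ c₂ ha₀ hc ht).1)
    (fun t ht => (phiV_relations c₁ c₂ ha₀ hc ht).2) ht k
  have key := hankelDet_identity (u := fun k => eulerD^[k] (phiV a c c₁ c₂ 0 0) t)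
    (v := fun k => eulerD^[k] (phiV a c c₁ c₂ 1 1) t) (fun k => (hr k).1) (fun k => (hr k).2) n
  have d₀ := mul_deriv_hankelDet_iterate_eulerD s₀ n ht
  have d₁ := mul_deriv_hankelDet_iterate_eulerD s₁ (n + 1) ht
  rw [hn] at h₁ ⊢
  rw [← hτ] at d₀ d₁
  rw [← d₀, ← d₁] at key
  simp only [hτ] at h₀ h₁ key ⊢
  rw [div_eq_iff (mul_ne_zero h₀ h₁), key]
  field_simp
  ring
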